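/- arXiv:1211.4760 — 6 statements merged into one kernel-verified Lean document; each statement's English description precedes it below -/
import Mathlib

section
/- Consider the infinite-volume classical sandpile model on ℤ with parallel toppling map T, started from a random configuration η with law μ_ρ. If 0 < ρ < 1, then lim_{t→∞} α_ρ(t) = 0, where α_ρ(t) = μ_ρ(η : T^t(η)(0) ≥ 2) is the density of unstable sites at time t. -/
open MeasureTheory Filter Topology

/-- The parallel toppling map of the classical sandpile model on `ℤ`:
every unstable site (height `≥ 2`) loses two particles, one to each neighbor. -/
def parT (η : ℤ → ℕ) : ℤ → ℕ := fun x =>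
  (η x - if 2 ≤ η x then 2 else 0)
    + (if 2 ≤ η (x - 1) then 1 else 0)
    + (if 2 ≤ η (x + 1) then 1 else 0)

namespace Sandpile

/-- The odometer of parallel toppling: the number of times each site has toppled
before time `t`. -/
def odometer (η : ℤ → ℕ) : ℕ → ℤ → ℤ
  | 0 => fun _ => 0
  | t + 1 => fun x => odometer η t x + if 2 ≤ (parT^[t] η) x then 1 else 0

lemma iterate_parT_eq_add_laplacian_odometer (η : ℤ → ℕ) (t : ℕ) (x : ℤ) :
    ((parT^[t] η) x : ℤ) = η x + odometer η t (x - 1) + odometer η t (x + 1)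
      - 2 * odometer η t x := by
  induction t with
  | zero => simp [odometer]
  | succ t ih =>
    rw [Function.iterate_succ_apply']
    simp only [odometer, parT]
    split_ifs <;> push_cast <;> omega

/-- Least action principle: a nonnegative function that stabilizes `η` dominates the odometer. -/
lemma odometer_le (η : ℤ → ℕ) (u : ℤ → ℤ) (hu : ∀ x, 0 ≤ u x)
    (hst : ∀ x, η x + u (x - 1) + u (x + 1) - 2 * u x ≤ 1) (t : ℕ) (x : ℤ) :
    odometer η t x ≤ u x := by
  induction t generalizing x with
  | zero => exact hu x
  | succ t ih =>
    have h := iterate_parT_eq_add_laplacian_odometer η t x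
    have := ih (x - 1)
    have := ih (x + 1)
    have := ih x
    have := hst x
    simp only [odometer]
    split_ifs <;> omega

lemma monotone_odometer (η : ℤ → ℕ) (x : ℤ) : Monotone fun t => odometer η t x := by
  refine monotone_nat_of_le_succ fun t => ?_
  simp only [odometer]
  split_ifs <;> omega

/-- If `η` can be stabilized, every site is eventually stable under parallel toppling. -/
lemma eventually_stable (η : ℤ → ℕ) (u : ℤ → ℤ) (hu : ∀ x, 0 ≤ u x)
    (hst : ∀ x, η x + u (x - 1) + u (x + 1) - 2 * u x ≤ 1) (x : ℤ) :
    ∀ᶠ t in atTop, ¬ 2 ≤ (parT^[t] η) x := by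
  by_contra hcon
  have hfreq : ∀ N, ∃ t ≥ N, 2 ≤ (parT^[t] η) x :=
    frequently_atTop.1 hcon
  have hunb : ∀ n : ℕ, ∃ t, (n : ℤ) ≤ odometer η t x := by
    intro n
    induction n with
    | zero => exact ⟨0, by simp [odometer]⟩
    | succ n ih =>
      obtain ⟨N, hN⟩ := ih
      obtain ⟨t, ht, h2⟩ := hfreq N
      refine ⟨t + 1, ?_⟩
      have hm : odometer η N x ≤ odometer η t x := monotone_odometer η x ht
      simp only [odometer, if_pos h2]
      push_cast
      omega
  obtain ⟨t, ht⟩ := hunb ((u x).toNat + 1)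
  have := odometer_le η u hu hst t x
  have := hu x
  omega

lemma exists_lower_bound_sum (s : ℕ → ℤ) (hs : ∀ᶠ n in atTop, 0 ≤ s n) :
    ∃ C, ∀ n, C ≤ ∑ i ∈ Finset.range n, s i := by
  obtain ⟨N, hN⟩ := eventually_atTop.1 hs
  have hge : ∀ n, N ≤ n → ∑ i ∈ Finset.range N, s i ≤ ∑ i ∈ Finset.range n, s i := fun n hn =>
    Nat.le_induction le_rfl (fun m hm ih => by
      rw [Finset.sum_range_succ]
      have := hN m hm
      omega) n hn
  obtain ⟨C, hC⟩ := ((Finset.range (N + 1)).image fun n => ∑ i ∈ Finset.range n, s i).bddBelow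
  have hC' : ∀ n ≤ N, C ≤ ∑ i ∈ Finset.range n, s i := fun n hn =>
    hC (Finset.mem_coe.2 (Finset.mem_image_of_mem _ (Finset.mem_range.2 (by omega))))
  refine ⟨C, fun n => ?_⟩
  rcases le_total n N with h | h
  · exact hC' n h
  · exact (hC' N le_rfl).trans (hge n h)

/-- A function on `ℤ` whose partial sums are eventually nonnegative in both directions is the
Laplacian of a nonnegative function. -/
lemma exists_nonneg_laplacian_eq (d : ℤ → ℤ)
    (hr : ∀ᶠ n : ℕ in atTop, 0 ≤ ∑ j ∈ Finset.range n, d (j + 1))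
    (hl : ∀ᶠ n : ℕ in atTop, 0 ≤ ∑ j ∈ Finset.range n, d (-j)) :
    ∃ u : ℤ → ℤ, (∀ x, 0 ≤ u x) ∧ ∀ x, u (x - 1) + u (x + 1) - 2 * u x = d x := by
  set f : ℕ → ℤ := fun n => ∑ i ∈ Finset.range n, ∑ j ∈ Finset.range i, d (j + 1) with hf
  set g : ℕ → ℤ := fun n => ∑ i ∈ Finset.range n, ∑ j ∈ Finset.range (i + 1), d (-j) with hg
  obtain ⟨A, hA⟩ : ∃ A, ∀ n, A ≤ f n := exists_lower_bound_sum _ hr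
  obtain ⟨B, hB⟩ : ∃ B, ∀ n, B ≤ g n :=
    exists_lower_bound_sum _ ((tendsto_add_atTop_nat 1).eventually hl)
  have hf2 : ∀ n, f n + f (n + 2) - 2 * f (n + 1) = d (n + 1) := by
    intro n
    simp only [hf, Finset.sum_range_succ]
    ring
  have hg2 : ∀ n, g n + g (n + 2) - 2 * g (n + 1) = d (-(n + 1 : ℕ)) := by
    intro n
    simp only [hg, Finset.sum_range_succ]
    ring
  have hf0 : f 0 = 0 := by simp [hf]
  have hf1 : f 1 = 0 := by simp [hf]
  have hg0 : g 0 = 0 := by simp [hg]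
  have hg1 : g 1 = d 0 := by simp [hg]
  refine ⟨fun x => f x.toNat + g (-x).toNat - A - B, fun x => ?_, fun x => ?_⟩
  · have := hA x.toNat
    have := hB (-x).toNat
    linarith
  · beta_reduce
    rcases lt_trichotomy x 0 with hx | rfl | hx
    · obtain ⟨n, rfl⟩ : ∃ n : ℕ, x = -((n + 1 : ℕ) : ℤ) := ⟨(-x).toNat - 1, by omega⟩
      have h := hg2 n
      rw [show (-((n + 1 : ℕ) : ℤ) - 1).toNat = 0 by omega,
        show (-((n + 1 : ℕ) : ℤ) + 1).toNat = 0 by omega,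
        show (-((n + 1 : ℕ) : ℤ)).toNat = 0 by omega,
        show (-(-((n + 1 : ℕ) : ℤ) - 1)).toNat = n + 2 by omega,
        show (-(-((n + 1 : ℕ) : ℤ) + 1)).toNat = n by omega,
        show (-(-((n + 1 : ℕ) : ℤ))).toNat = n + 1 by omega, hf0]
      linarith
    · simp [hf0, hf1, hg0, hg1]
      ring
    · obtain ⟨n, rfl⟩ : ∃ n : ℕ, x = (n : ℤ) + 1 := ⟨x.toNat - 1, by omega⟩
      have h := hf2 n
      rw [show ((n : ℤ) + 1 - 1).toNat = n by omega,
        show ((n : ℤ) + 1 + 1).toNat = n + 2 by omega,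
        show ((n : ℤ) + 1).toNat = n + 1 by omega,
        show (-((n : ℤ) + 1 - 1)).toNat = 0 by omega,
        show (-((n : ℤ) + 1 + 1)).toNat = 0 by omega,
        show (-((n : ℤ) + 1)).toNat = 0 by omega, hg0]
      linarith

lemma measurable_parT : Measurable parT := by
  refine measurable_pi_lambda _ fun x => ?_
  have h : ∀ a b : ℕ, ∀ y : ℤ, Measurable fun η : ℤ → ℕ => if 2 ≤ η y then a else b :=
    fun a b y => (measurable_of_countable fun n : ℕ => if 2 ≤ n then a else b).comp
      (measurable_pi_apply y)
  exact (((measurable_pi_apply x).sub (h 2 0 x)).add (h 1 0 (x - 1))).add (h 1 0 (x + 1))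

section Poisson

open ProbabilityTheory

lemma hasSum_mean_poisson (ρ : ℝ) :
    HasSum (fun n : ℕ => Real.exp (-ρ) * ρ ^ n / n.factorial * n) ρ := by
  rw [← hasSum_nat_add_iff' 1]
  have h := ((NormedSpace.expSeries_div_hasSum_exp ρ).mul_left (Real.exp (-ρ))).mul_left ρ
  rw [← Real.exp_eq_exp_ℝ, ← Real.exp_add] at h
  convert! h using 1
  · ext n
    rw [Nat.factorial_succ]
    push_cast
    field_simp
    ring
  · simp

lemma integrable_natCast_poissonMeasure (r : NNReal) :
    Integrable (fun n : ℕ => (n : ℝ)) (poissonMeasure r) := by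
  rw [integrable_poissonMeasure_iff]
  simpa using (hasSum_mean_poisson r).summable

lemma integral_natCast_poissonMeasure (r : NNReal) :
    ∫ n : ℕ, (n : ℝ) ∂poissonMeasure r = r := by
  rw [integral_poissonMeasure]
  simpa using (hasSum_mean_poisson r).tsum_eq

variable {r : NNReal} {μ : Measure (ℤ → ℕ)}

lemma map_eval_eq_poissonMeasure
    (hμ : ∀ (S : Finset ℤ) (k : ℤ → ℕ), μ {η | ∀ x ∈ S, η x = k x}
      = ∏ x ∈ S, ENNReal.ofReal (Real.exp (-r) * r ^ k x / (k x).factorial)) (x : ℤ) :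
    μ.map (fun η => η x) = poissonMeasure r := by
  refine Measure.ext_of_singleton fun n => ?_
  rw [Measure.map_apply (measurable_pi_apply x) (measurableSet_singleton n),
    poissonMeasure_singleton]
  have h := hμ {x} fun _ => n
  simp only [Finset.mem_singleton, forall_eq, Finset.prod_singleton] at h
  exact h

lemma indepFun_eval [IsProbabilityMeasure μ]
    (hμ : ∀ (S : Finset ℤ) (k : ℤ → ℕ), μ {η | ∀ x ∈ S, η x = k x}
      = ∏ x ∈ S, ENNReal.ofReal (Real.exp (-r) * r ^ k x / (k x).factorial))
    {x y : ℤ} (hxy : x ≠ y) :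
    IndepFun (fun η : ℤ → ℕ => η x) (fun η : ℤ → ℕ => η y) μ := by
  rw [indepFun_iff_map_prod_eq_prod_map_map (measurable_pi_apply x).aemeasurable
    (measurable_pi_apply y).aemeasurable, map_eval_eq_poissonMeasure hμ,
    map_eval_eq_poissonMeasure hμ]
  refine Measure.ext_of_singleton fun ⟨m, n⟩ => ?_
  rw [Measure.map_apply ((measurable_pi_apply x).prodMk (measurable_pi_apply y))
    (measurableSet_singleton _), ← Set.singleton_prod_singleton, Measure.prod_prod,
    poissonMeasure_singleton, poissonMeasure_singleton]
  have h := hμ {x, y} fun z => if z = x then m else n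
  rw [Finset.prod_pair hxy] at h
  simp only [Finset.mem_insert, Finset.mem_singleton, forall_eq_or_imp, forall_eq, if_true,
    if_neg hxy.symm] at h
  rw [← h]
  congr 1

/-- In the subcritical case, the partial sums of `1 - η` along an injective sequence of sites are
almost surely eventually nonnegative. -/
lemma ae_eventually_sum_nonneg [IsProbabilityMeasure μ] (hr : r < 1)
    (hμ : ∀ (S : Finset ℤ) (k : ℤ → ℕ), μ {η | ∀ x ∈ S, η x = k x}
      = ∏ x ∈ S, ENNReal.ofReal (Real.exp (-r) * r ^ k x / (k x).factorial))
    (φ : ℕ → ℤ) (hφ : Function.Injective φ) :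
    ∀ᵐ η ∂μ, ∀ᶠ n : ℕ in atTop, 0 ≤ ∑ j ∈ Finset.range n, (1 - (η (φ j) : ℤ)) := by
  have hmap := map_eval_eq_poissonMeasure hμ
  have hcast : Measurable (fun n : ℕ => (n : ℝ)) := measurable_of_countable _
  have hint : Integrable (fun η : ℤ → ℕ => (η (φ 0) : ℝ)) μ := by
    have h := integrable_natCast_poissonMeasure r
    rw [← hmap (φ 0)] at h
    exact h.comp_measurable (measurable_pi_apply _)
  have hmean : ∫ η : ℤ → ℕ, (η (φ 0) : ℝ) ∂μ = r := by
    rw [← integral_natCast_poissonMeasure r, ← hmap (φ 0),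
      integral_map (measurable_pi_apply _).aemeasurable hcast.aestronglyMeasurable]
  have hlaw := strong_law_ae_real (μ := μ) (fun j η => (η (φ j) : ℝ)) hint
    (fun i j hij => (indepFun_eval hμ (hφ.ne hij)).comp hcast hcast)
    (fun i => IdentDistrib.comp (u := fun n : ℕ => (n : ℝ))
      ⟨(measurable_pi_apply _).aemeasurable, (measurable_pi_apply _).aemeasurable,
        (hmap (φ i)).trans (hmap (φ 0)).symm⟩ hcast)
  filter_upwards [hlaw] with η hη
  rw [hmean] at hη
  filter_upwards [hη.eventually_lt_const (show (r : ℝ) < 1 from mod_cast hr),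
    eventually_gt_atTop 0] with n hn hn0
  rw [div_lt_one (by exact_mod_cast hn0)] at hn
  have h : ∑ j ∈ Finset.range n, (η (φ j) : ℤ) < n := by exact_mod_cast hn
  simp only [Finset.sum_sub_distrib, Finset.sum_const, Finset.card_range, nsmul_eq_mul, mul_one]
  omega

end Poisson

end Sandpile

/-- in the infinite-volume classical sandpile on `ℤ` started from
i.i.d. Poisson(`ρ`) heights (`μ` is the product measure with Poisson-`ρ` marginals)
with `0 < ρ < 1`, the density `α_ρ(t) = μ(T^t η has an unstable site at 0)` of
unstable sites tends to `0` as `t → ∞`. -/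
theorem activity_density_subcritical (ρ : ℝ) (hρ₀ : 0 < ρ) (hρ₁ : ρ < 1)
    (μ : Measure (ℤ → ℕ)) [IsProbabilityMeasure μ]
    (hμ : ∀ (S : Finset ℤ) (k : ℤ → ℕ),
      μ {η | ∀ x ∈ S, η x = k x}
        = ∏ x ∈ S, ENNReal.ofReal (Real.exp (-ρ) * ρ ^ k x / (k x).factorial)) :
    Tendsto (fun t : ℕ => (μ {η | 2 ≤ (parT^[t] η) 0}).toReal) atTop (𝓝 0) := by
  lift ρ to NNReal using hρ₀.le
  have hρ : ρ < 1 := by exact_mod_cast hρ₁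
  have hr := Sandpile.ae_eventually_sum_nonneg hρ hμ (fun j => (j : ℤ) + 1)
    fun a b h => by simpa using h
  have hl := Sandpile.ae_eventually_sum_nonneg hρ hμ (fun j => -(j : ℤ))
    fun a b h => by simpa using h
  have hlim := tendsto_measure_of_ae_tendsto_indicator_of_isFiniteMeasure (μ := μ) atTop
    (As := fun t : ℕ => {η | 2 ≤ (parT^[t] η) 0}) MeasurableSet.empty
    (fun t => ((measurable_pi_apply 0).comp (Sandpile.measurable_parT.iterate t))
      measurableSet_Ici) (by
      filter_upwards [hr, hl] with η hηr hηl
      obtain ⟨u, hu, hst⟩ :=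
        Sandpile.exists_nonneg_laplacian_eq (fun x => 1 - (η x : ℤ)) hηr hηl
      filter_upwards [Sandpile.eventually_stable η u hu
        (fun x => by have := hst x; omega) 0] with t ht
      simpa using ht)
  rw [measure_empty] at hlim
  exact (ENNReal.tendsto_toReal ENNReal.zero_ne_top).comp hlim
end

section
/- Consider the infinite-volume classical sandpile model on ℤ with parallel toppling map T, started from a random configuration η with law μ_ρ. If ρ > 2, then lim_{t→∞} α_ρ(t) = 1, where α_ρ(t) = μ_ρ(η : T^t(η)(0) ≥ 2) is the density of unstable sites at time t. -/
open MeasureTheory Filter Topology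

open ProbabilityTheory
open scoped NNReal Nat

/-- The number of times `s < t` at which the site `x` is stable. -/
def stableCount (η : ℤ → ℕ) (t : ℕ) (x : ℤ) : ℕ :=
  ∑ s ∈ Finset.range t, if 2 ≤ (parT^[s] η) x then 0 else 1

lemma stableCount_succ (η : ℤ → ℕ) (t : ℕ) (x : ℤ) :
    stableCount η (t + 1) x
      = stableCount η t x + if 2 ≤ (parT^[t] η) x then 0 else 1 :=
  Finset.sum_range_succ _ _

lemma stableCount_mono (η : ℤ → ℕ) (x : ℤ) : Monotone fun t => stableCount η t x :=
  monotone_nat_of_le_succ fun t => by rw [stableCount_succ]; exact Nat.le_add_right _ _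

/-- The heights at time `t` are the initial heights minus the discrete Laplacian of the number of
stable times. -/
lemma iterate_parT_eq_sub_laplacian (η : ℤ → ℕ) (t : ℕ) (x : ℤ) :
    ((parT^[t] η) x : ℤ) = η x - ((stableCount η t (x - 1) : ℤ) + stableCount η t (x + 1)
      - 2 * stableCount η t x) := by
  induction t with
  | zero => simp [stableCount]
  | succ t ih =>
    rw [Function.iterate_succ_apply']
    simp only [stableCount_succ, parT]
    split_ifs <;> push_cast <;> omega

/-- Least action principle for the number of stable times. -/
lemma stableCount_le_of_laplacian_le (η : ℤ → ℕ) (w : ℤ → ℤ) (hw : ∀ x, 0 ≤ w x)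
    (hΔ : ∀ x, w (x - 1) + w (x + 1) - 2 * w x ≤ η x - 2) (t : ℕ) (x : ℤ) :
    (stableCount η t x : ℤ) ≤ w x := by
  induction t generalizing x with
  | zero => simpa [stableCount] using hw x
  | succ t ih =>
    have h := iterate_parT_eq_sub_laplacian η t x
    have h0 := ih x
    have h1 := ih (x - 1)
    have h2 := ih (x + 1)
    have h3 := hΔ x
    rw [stableCount_succ]
    split_ifs <;> push_cast <;> omega

lemma eventually_two_le_iterate_parT (η : ℤ → ℕ) (w : ℤ → ℤ) (hw : ∀ x, 0 ≤ w x)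
    (hΔ : ∀ x, w (x - 1) + w (x + 1) - 2 * w x ≤ η x - 2) (x : ℤ) :
    ∀ᶠ t in atTop, 2 ≤ (parT^[t] η) x := by
  have hbdd : BddAbove (Set.range fun t => stableCount η t x) := by
    refine ⟨(w x).toNat, ?_⟩
    rintro _ ⟨t, rfl⟩
    have := stableCount_le_of_laplacian_le η w hw hΔ t x
    change stableCount η t x ≤ _
    omega
  have hlim := tendsto_atTop_ciSup (stableCount_mono η x) hbdd
  rw [nhds_discrete, tendsto_pure] at hlim
  filter_upwards [hlim, (tendsto_add_atTop_nat 1).eventually hlim] with t h1 h2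
  rw [stableCount_succ] at h2
  split_ifs at h2 with h
  · exact h
  · omega

/-- The double partial sum of `f - 2`, starting with slope `-1`. -/
def doubleSum (f : ℕ → ℕ) (n : ℕ) : ℤ :=
  ∑ k ∈ Finset.range n, (-1 + ∑ i ∈ Finset.range k, ((f i : ℤ) - 2))

lemma doubleSum_second_difference (f : ℕ → ℕ) (n : ℕ) :
    doubleSum f n + doubleSum f (n + 2) - 2 * doubleSum f (n + 1) = f n - 2 := by
  simp only [doubleSum, Finset.sum_range_succ]
  ring

lemma exists_le_doubleSum (f : ℕ → ℕ)
    (hf : Tendsto (fun k => ∑ i ∈ Finset.range k, ((f i : ℤ) - 2)) atTop atTop) :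
    ∃ C : ℤ, ∀ n, C ≤ doubleSum f n := by
  obtain ⟨N, hN⟩ := eventually_atTop.1 (hf.eventually_ge_atTop 1)
  obtain ⟨C, hC⟩ := ((Finset.range (N + 1)).image (doubleSum f)).bddBelow
  have hC' : ∀ n ≤ N, C ≤ doubleSum f n := fun n hn =>
    hC (Finset.mem_coe.2 (Finset.mem_image_of_mem _ (Finset.mem_range.2 (by omega))))
  refine ⟨C, fun n => ?_⟩
  rcases le_total n N with h | h
  · exact hC' n h
  · induction n, h using Nat.le_induction with
    | base => exact hC' N le_rfl
    | succ n hn ih =>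
      have := hN n hn
      rw [doubleSum, Finset.sum_range_succ, ← doubleSum]
      linarith

/-- If the partial sums of `η - 2` diverge to `+∞` in both directions, every site is eventually
always unstable. -/
lemma eventually_two_le_iterate_parT_of_tendsto (η : ℤ → ℕ)
    (hR : Tendsto (fun k => ∑ i ∈ Finset.range k, ((η (i + 1) : ℤ) - 2)) atTop atTop)
    (hL : Tendsto (fun k => ∑ i ∈ Finset.range k, ((η (-(i + 1)) : ℤ) - 2)) atTop atTop)
    (x : ℤ) : ∀ᶠ t in atTop, 2 ≤ (parT^[t] η) x := by
  set fR : ℕ → ℕ := fun i => η (i + 1) with hfR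
  set fL : ℕ → ℕ := fun i => η (-(i + 1)) with hfL
  obtain ⟨A, hA⟩ := exists_le_doubleSum fR hR
  obtain ⟨B, hB⟩ := exists_le_doubleSum fL hL
  let w : ℤ → ℤ := fun x =>
    (if 0 ≤ x then doubleSum fR x.toNat else doubleSum fL (-x).toNat) - min A B
  have hwR : ∀ n : ℕ, w n = doubleSum fR n - min A B := fun n => by simp [w]
  have hwL : ∀ n : ℕ, w (-n) = doubleSum fL n - min A B := fun n => by
    rcases n with _ | n
    · simp [w, doubleSum]
    · simp only [w]
      rw [if_neg (by omega)]
      simp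
  refine eventually_two_le_iterate_parT η w (fun x => ?_) (fun x => ?_) x
  · simp only [w]
    split_ifs
    · have := hA x.toNat
      omega
    · have := hB (-x).toNat
      omega
  · rcases lt_trichotomy x 0 with h | rfl | h
    · obtain ⟨n, rfl⟩ : ∃ n : ℕ, x = -((n + 1 : ℕ) : ℤ) := ⟨(-x).toNat - 1, by omega⟩
      have e1 : -((n + 1 : ℕ) : ℤ) - 1 = -((n + 2 : ℕ) : ℤ) := by push_cast; ring
      have e2 : -((n + 1 : ℕ) : ℤ) + 1 = -((n : ℕ) : ℤ) := by push_cast; ring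
      have := doubleSum_second_difference fL n
      rw [e1, e2, hwL, hwL, hwL]
      simp only [hfL] at this ⊢
      push_cast
      linarith
    · have h1 := hwR 1
      have h2 := hwL 1
      have h3 := hwR 0
      simp only [doubleSum, Finset.sum_range_one, Finset.sum_range_zero, Nat.cast_one,
        Nat.cast_zero] at h1 h2 h3
      rw [zero_sub, zero_add, h1, h2, h3]
      omega
    · obtain ⟨n, rfl⟩ : ∃ n : ℕ, x = ((n + 1 : ℕ) : ℤ) := ⟨x.toNat - 1, by omega⟩
      have e1 : ((n + 1 : ℕ) : ℤ) - 1 = (n : ℕ) := by push_cast; ring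
      have e2 : ((n + 1 : ℕ) : ℤ) + 1 = ((n + 2 : ℕ) : ℤ) := by push_cast; ring
      have := doubleSum_second_difference fR n
      rw [e1, e2, hwR, hwR, hwR]
      simp only [hfR] at this ⊢
      push_cast
      linarith

lemma measurable_parT : Measurable parT := by
  have hunstable : ∀ (y : ℤ) (a : ℕ), Measurable fun η : ℤ → ℕ => if 2 ≤ η y then a else 0 :=
    fun y a => (Measurable.of_discrete (f := fun n : ℕ => if 2 ≤ n then a else 0)).comp
      (measurable_pi_apply y)
  refine measurable_pi_lambda _ fun x => ?_
  exact (((measurable_pi_apply x).sub (hunstable x 2)).add (hunstable (x - 1) 1)).add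
    (hunstable (x + 1) 1)

lemma hasSum_mul_id_poisson (r : ℝ≥0) :
    HasSum (fun n : ℕ => Real.exp (-r) * r ^ n / n ! * (n : ℝ)) r := by
  rw [← hasSum_nat_add_iff' 1]
  convert! (hasSum_one_poissonMeasure r).mul_left (r : ℝ) using 1
  · ext n
    rw [Nat.factorial_succ]
    push_cast
    field_simp
    ring
  · simp

lemma integrable_natCast_poissonMeasure (r : ℝ≥0) :
    Integrable (fun n : ℕ => (n : ℝ)) (poissonMeasure r) := by
  rw [integrable_poissonMeasure_iff]
  simpa using (hasSum_mul_id_poisson r).summable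

lemma integral_natCast_poissonMeasure (r : ℝ≥0) :
    ∫ n : ℕ, (n : ℝ) ∂poissonMeasure r = r := by
  rw [integral_poissonMeasure]
  exact (hasSum_mul_id_poisson r).tsum_eq

/-- For independent Poisson variables of mean greater than `2`, the partial sums of `X - 2`
almost surely diverge to `+∞`. -/
lemma ae_tendsto_sum_sub_two {Ω : Type*} [MeasurableSpace Ω] {P : Measure Ω}
    {r : ℝ≥0} (hr : 2 < r) (X : ℕ → Ω → ℕ)
    (hlaw : ∀ i, HasLaw (X i) (poissonMeasure r) P)
    (hindep : Pairwise fun i j => IndepFun (X i) (X j) P) :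
    ∀ᵐ ω ∂P, Tendsto (fun k => ∑ i ∈ Finset.range k, ((X i ω : ℤ) - 2)) atTop atTop := by
  have hcast : Measurable (fun n : ℕ => (n : ℝ)) := .of_discrete
  have hint : Integrable (fun ω => (X 0 ω : ℝ)) P := by
    have := integrable_natCast_poissonMeasure r
    rw [← (hlaw 0).map_eq] at this
    exact this.comp_aemeasurable (hlaw 0).aemeasurable
  have hmean : ∫ ω, (X 0 ω : ℝ) ∂P = r := by
    rw [← integral_natCast_poissonMeasure, ← (hlaw 0).map_eq,
      integral_map (hlaw 0).aemeasurable hcast.aestronglyMeasurable]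
  have hslln := strong_law_ae_real (fun i ω => (X i ω : ℝ)) hint
    (fun i j hij => (hindep hij).comp hcast hcast)
    (fun i => IdentDistrib.comp
      ⟨(hlaw i).aemeasurable, (hlaw 0).aemeasurable, by rw [(hlaw i).map_eq, (hlaw 0).map_eq]⟩
      hcast)
  filter_upwards [hslln] with ω hω
  rw [hmean] at hω
  rw [← tendsto_intCast_atTop_iff (R := ℝ)]
  have hpos : (0 : ℝ) < r - 2 := sub_pos.2 (by exact_mod_cast hr)
  refine ((hω.sub_const 2).pos_mul_atTop hpos tendsto_natCast_atTop_atTop).congr' ?_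
  filter_upwards [eventually_gt_atTop 0] with k hk
  have : (k : ℝ) ≠ 0 := by positivity
  simp only [Int.cast_sum, Int.cast_sub, Int.cast_natCast, Finset.sum_sub_distrib,
    Finset.sum_const, Finset.card_range, nsmul_eq_mul, Int.cast_mul]
  field_simp
  push_cast
  ring

/-- in the infinite-volume classical sandpile on `ℤ` started from
i.i.d. Poisson(`ρ`) heights (`μ` is the product measure with Poisson-`ρ` marginals)
with `ρ > 2`, the density `α_ρ(t) = μ(T^t η has an unstable site at 0)` of
unstable sites tends to `1` as `t → ∞`. -/
theorem activity_density_supercritical (ρ : ℝ) (hρ : 2 < ρ)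
    (μ : Measure (ℤ → ℕ)) [IsProbabilityMeasure μ]
    (hμ : ∀ (S : Finset ℤ) (k : ℤ → ℕ),
      μ {η | ∀ x ∈ S, η x = k x}
        = ∏ x ∈ S, ENNReal.ofReal (Real.exp (-ρ) * ρ ^ k x / (k x).factorial)) :
    Tendsto (fun t : ℕ => (μ {η | 2 ≤ (parT^[t] η) 0}).toReal) atTop (𝓝 1) := by
  lift ρ to ℝ≥0 using by linarith
  have hlaw : ∀ x : ℤ, HasLaw (fun η : ℤ → ℕ => η x) (poissonMeasure ρ) μ := fun x => by
    refine ⟨(measurable_pi_apply x).aemeasurable, Measure.ext_of_singleton fun n => ?_⟩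
    rw [Measure.map_apply (measurable_pi_apply x) (measurableSet_singleton n),
      poissonMeasure_singleton]
    simpa [Set.preimage] using hμ {x} fun _ => n
  have hindep : ∀ x y : ℤ, x ≠ y →
      IndepFun (fun η : ℤ → ℕ => η x) (fun η => η y) μ := fun x y hxy => by
    rw [indepFun_iff_map_prod_eq_prod_map_map (measurable_pi_apply x).aemeasurable
      (measurable_pi_apply y).aemeasurable, (hlaw x).map_eq, (hlaw y).map_eq]
    refine Measure.ext_of_singleton fun ⟨m, n⟩ => ?_
    rw [Measure.map_apply ((measurable_pi_apply x).prodMk (measurable_pi_apply y))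
      (measurableSet_singleton _), ← Set.singleton_prod_singleton, Measure.prod_prod,
      poissonMeasure_singleton, poissonMeasure_singleton]
    have := hμ {x, y} fun z => if z = x then m else n
    rw [Finset.prod_pair hxy, if_pos rfl, if_neg hxy.symm] at this
    rw [← this]
    congr 1
    ext η
    simp [hxy.symm]
  have hρ' : 2 < ρ := by exact_mod_cast hρ
  have hae : ∀ᵐ η ∂μ, ∀ᶠ t in atTop, 2 ≤ (parT^[t] η) 0 := by
    filter_upwards [
      ae_tendsto_sum_sub_two hρ' (fun i η => η ((i : ℤ) + 1)) (fun i => hlaw _)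
        (fun i j hij => hindep _ _ (by omega)),
      ae_tendsto_sum_sub_two hρ' (fun i η => η (-((i : ℤ) + 1))) (fun i => hlaw _)
        (fun i j hij => hindep _ _ (by omega))] with η hR hL
    exact eventually_two_le_iterate_parT_of_tendsto η hR hL 0
  have hmeas : ∀ t : ℕ, MeasurableSet {η : ℤ → ℕ | 2 ≤ (parT^[t] η) 0} := fun t =>
    measurableSet_le measurable_const
      ((measurable_pi_apply 0).comp (measurable_parT.iterate t))
  have hlim : Tendsto (fun t : ℕ => μ {η | 2 ≤ (parT^[t] η) 0}) atTop (𝓝 (μ Set.univ)) :=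
    tendsto_measure_of_ae_tendsto_indicator_of_isFiniteMeasure atTop MeasurableSet.univ hmeas
      (by simpa using hae)
  rw [measure_univ] at hlim
  simpa [Function.comp_def] using (ENNReal.tendsto_toReal ENNReal.one_ne_top).comp hlim
end

section
/- Let m ≥ 3 and let η : ℤ/mℤ → ℕ be a height configuration on the cycle with m sites whose total number of particles satisfies ∑_x η(x) < m. Then there is no infinite sequence η = η₀, η₁, η₂, … in which each η_{k+1} is obtained from η_k by a symmetric toppling of an unstable site; consequently every maximal sequence of symmetric topplings starting from η terminates after finitely many steps in a stable configuration. -/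
/-- A symmetric toppling on the cycle `ℤ/mℤ`: an unstable site `x` (height `≥ 2`)
loses two particles, one going to each of its neighbors `x - 1` and `x + 1`. -/
def SymStep {m : ℕ} (η η' : ZMod m → ℕ) : Prop :=
  ∃ x : ZMod m, 2 ≤ η x ∧
    η' = fun y =>
      (η y - if y = x then 2 else 0)
        + (if y = x - 1 then 1 else 0)
        + (if y = x + 1 then 1 else 0)

/-- `ToppledAt x η η'` says that `η'` arises from `η` by toppling the unstable site `x`. -/
def ToppledAt {m : ℕ} (x : ZMod m) (η η' : ZMod m → ℕ) : Prop :=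
  2 ≤ η x ∧ ∀ y, η' y + (if y = x then 2 else 0) =
    η y + (if y = x - 1 then 1 else 0) + (if y = x + 1 then 1 else 0)

theorem SymStep.exists_toppledAt {m : ℕ} {η η' : ZMod m → ℕ} (h : SymStep η η') :
    ∃ x, ToppledAt x η η' := by
  obtain ⟨x, hx, rfl⟩ := h
  refine ⟨x, hx, fun y => ?_⟩
  by_cases hy : y = x
  · subst hy
    simp only [if_true]
    omega
  · simp only [hy, if_false]
    omega

/-- The effect of a toppling on a weighted particle count. -/
theorem ToppledAt.sum_mul {m : ℕ} [NeZero m] {x : ZMod m} {η η' : ZMod m → ℕ}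
    (h : ToppledAt x η η') (w : ZMod m → ℕ) :
    ∑ y, η' y * w y + 2 * w x = ∑ y, η y * w y + w (x - 1) + w (x + 1) := by
  have key : ∑ y, (η' y + (if y = x then 2 else 0)) * w y =
      ∑ y, (η y + (if y = x - 1 then 1 else 0) + (if y = x + 1 then 1 else 0)) * w y :=
    Finset.sum_congr rfl fun y _ => by rw [h.2 y]
  simpa [add_mul, Finset.sum_add_distrib, ite_mul] using key

theorem ToppledAt.sum_eq {m : ℕ} [NeZero m] {x : ZMod m} {η η' : ZMod m → ℕ}
    (h : ToppledAt x η η') : ∑ y, η' y = ∑ y, η y := by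
  have := h.sum_mul fun _ => 1
  simp only [mul_one] at this
  omega

/-- The Green-type weight `d (m - d)`, where `d` is the clockwise distance from `z`. -/
def cutWeight {m : ℕ} (z y : ZMod m) : ℕ := (y - z).val * (m - (y - z).val)

theorem cutWeight_add_natCast {m : ℕ} [NeZero m] (z : ZMod m) {d : ℕ} (hd : d ≤ m) :
    cutWeight z (z + d) = d * (m - d) := by
  rcases hd.lt_or_eq with h | rfl
  · simp [cutWeight, ZMod.val_natCast, Nat.mod_eq_of_lt h]
  · simp [cutWeight]

theorem cutWeight_neighbors {m : ℕ} [NeZero m] {z x : ZMod m} (hx : x ≠ z) :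
    cutWeight z (x - 1) + cutWeight z (x + 1) + 2 = 2 * cutWeight z x := by
  obtain ⟨e, he⟩ : ∃ e, (x - z).val = e + 1 :=
    Nat.exists_eq_succ_of_ne_zero (by simpa [ZMod.val_eq_zero, sub_eq_zero] using hx)
  have hlt := ZMod.val_lt (x - z)
  have hxe : x = z + ((e + 1 : ℕ) : ZMod m) := by
    rw [← he, ZMod.natCast_zmod_val]; ring
  have h₁ : x - 1 = z + (e : ZMod m) := by rw [hxe]; push_cast; ring
  have h₂ : x + 1 = z + ((e + 2 : ℕ) : ZMod m) := by rw [hxe]; push_cast; ring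
  rw [h₁, h₂, hxe, cutWeight_add_natCast z (by omega), cutWeight_add_natCast z (by omega),
    cutWeight_add_natCast z (by omega)]
  obtain ⟨c, rfl⟩ : ∃ c, m = e + 2 + c := ⟨m - (e + 2), by omega⟩
  rw [show e + 2 + c - e = c + 2 by omega, show e + 2 + c - (e + 2) = c by omega,
    show e + 2 + c - (e + 1) = c + 1 by omega]
  ring

/-- In an infinite toppling sequence every site topples. -/
theorem exists_topples_at {m : ℕ} [NeZero m] {f : ℕ → ZMod m → ℕ} {s : ℕ → ZMod m}
    (hs : ∀ k, ToppledAt (s k) (f k) (f (k + 1))) (z : ZMod m) : ∃ k, s k = z := by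
  by_contra! hz
  have hdec : ∀ k, ∑ y, f k y * cutWeight z y + 2 * k = ∑ y, f 0 y * cutWeight z y := by
    intro k
    induction k with
    | zero => rfl
    | succ k ih =>
      have h₁ := (hs k).sum_mul (cutWeight z)
      have h₂ := cutWeight_neighbors (hz k)
      omega
  have := hdec (∑ y, f 0 y * cutWeight z y + 1)
  omega

/-- After `k` topplings there is a record `L` of last toppling times (zero for sites that have not
toppled) such that each toppled site holds at least one particle for each of its neighbors that
toppled more recently. -/
theorem exists_lastToppling {m : ℕ} [NeZero m] {f : ℕ → ZMod m → ℕ}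
    {s : ℕ → ZMod m} (hs : ∀ k, ToppledAt (s k) (f k) (f (k + 1))) (k : ℕ) :
    ∃ L : ZMod m → ℕ, (∀ x, L x ≤ k) ∧ (∀ j < k, 0 < L (s j)) ∧
      (∀ x y, 0 < L x → L x = L y → x = y) ∧
      ∀ x, 0 < L x →
        (if L x < L (x - 1) then 1 else 0) + (if L x < L (x + 1) then 1 else 0) ≤ f k x := by
  induction k with
  | zero => exact ⟨fun _ => 0, by simp⟩
  | succ k ih =>
    obtain ⟨L, hle, hpos, hinj, hL⟩ := ih
    refine ⟨Function.update L (s k) (k + 1), fun x => ?_, fun j hj => ?_, fun x y => ?_,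
      fun x hx => ?_⟩
    · have := hle x
      by_cases h : x = s k
      · simp [h]
      · simp only [Function.update_of_ne h]; omega
    · by_cases h : s j = s k
      · simp [h]
      · rw [Function.update_of_ne h]
        refine hpos j (lt_of_le_of_ne (by omega) ?_)
        rintro rfl
        exact h rfl
    · have h₁ := hle x
      have h₂ := hle y
      have h₃ := hinj x y
      simp only [Function.update_apply]
      split_ifs <;> intros <;> first | omega | simp_all
    · have hstep := (hs k).2 x
      have e₁ : x - 1 = s k ↔ x = s k + 1 := sub_eq_iff_eq_add
      have e₂ : x + 1 = s k ↔ x = s k - 1 := eq_sub_iff_add_eq.symm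
      have h₁ := hle (x - 1)
      have h₂ := hle (x + 1)
      by_cases h : x = s k
      · have h₃ : ∀ y, Function.update L (s k) (k + 1) y ≤ k + 1 := fun y => by
          have := hle y
          simp only [Function.update_apply]
          split_ifs <;> omega
        have h₄ : Function.update L (s k) (k + 1) x = k + 1 := by rw [h]; simp
        rw [h₄, if_neg (h₃ _).not_gt, if_neg (h₃ _).not_gt]
        omega
      · rw [Function.update_of_ne h] at hx ⊢
        have h₃ := hL x hx
        simp only [Function.update_apply, e₁, e₂]
        rw [if_neg h] at hstep
        have h₄ := hle x
        split_ifs at * <;> omega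

/-- If distinct neighbors always carry distinct labels, then every edge of the cycle is counted
exactly once at its endpoint with the smaller label. -/
theorem sum_neighbors_lt {m : ℕ} [NeZero m] (L : ZMod m → ℕ) (hL : ∀ x, L x ≠ L (x + 1)) :
    ∑ x, ((if L x < L (x - 1) then 1 else 0) + (if L x < L (x + 1) then 1 else 0)) = m := by
  rw [Finset.sum_add_distrib,
    ← Equiv.sum_comp (Equiv.addRight (1 : ZMod m)) fun x => if L x < L (x - 1) then 1 else 0,
    ← Finset.sum_add_distrib]
  have : ∀ x ∈ Finset.univ, ((if L (Equiv.addRight (1 : ZMod m) x) <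
      L (Equiv.addRight (1 : ZMod m) x - 1) then 1 else 0) +
      (if L x < L (x + 1) then 1 else 0)) = 1 := by
    intro x _
    have := hL x
    simp only [Equiv.coe_addRight, add_sub_cancel_right]
    split_ifs <;> omega
  rw [Finset.sum_congr rfl this]
  simp [ZMod.card]

theorem le_sum_of_infinite_toppling {m : ℕ} [NeZero m] (hm : 3 ≤ m) {f : ℕ → ZMod m → ℕ}
    (hf : ∀ k, SymStep (f k) (f (k + 1))) : m ≤ ∑ x, f 0 x := by
  choose s hs using fun k => (hf k).exists_toppledAt
  have hsum : ∀ k, ∑ x, f k x = ∑ x, f 0 x := by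
    intro k
    induction k with
    | zero => rfl
    | succ k ih => rw [(hs k).sum_eq, ih]
  choose t ht using exists_topples_at hs
  obtain ⟨L, -, hpos, hinj, hL⟩ := exists_lastToppling hs (Finset.univ.sup t + 1)
  have hall : ∀ x, 0 < L x := fun x => by
    have := hpos (t x) (Nat.lt_succ_of_le (Finset.le_sup (Finset.mem_univ x)))
    rwa [ht] at this
  have : Fact (1 < m) := ⟨by omega⟩
  have hne : ∀ x, L x ≠ L (x + 1) := fun x h => by simpa using hinj x (x + 1) (hall x) h
  calc m = _ := (sum_neighbors_lt L hne).symm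
    _ ≤ ∑ x, f (Finset.univ.sup t + 1) x := Finset.sum_le_sum fun x _ => hL x (hall x)
    _ = ∑ x, f 0 x := hsum _

/-- on the cycle with `m ≥ 3` sites, if the total number of
particles is `< m`, then there is no infinite sequence of symmetric topplings,
and every maximal toppling sequence ends in a stable configuration. -/
theorem cycle_subcritical_stabilizes (m : ℕ) [NeZero m] (hm : 3 ≤ m)
    (η : ZMod m → ℕ) (htotal : ∑ x : ZMod m, η x < m) :
    (¬ ∃ f : ℕ → (ZMod m → ℕ), f 0 = η ∧ ∀ k, SymStep (f k) (f (k + 1))) ∧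
    (∀ ξ : ZMod m → ℕ, Relation.ReflTransGen SymStep η ξ →
      (∀ ξ', ¬ SymStep ξ ξ') → ∀ x, ξ x ≤ 1) := by
  constructor
  · rintro ⟨f, rfl, hf⟩
    exact (le_sum_of_infinite_toppling hm hf).not_gt htotal
  · intro ξ _ hξ x
    by_contra! hx
    exact hξ _ ⟨x, hx, rfl⟩
end

section
/- Let f ∈ [2/3, 1), and let ρ* be the unique positive solution of ρ − (1/2)(1 − e^{−2ρ}) = ((1 − f)/2)·(1 + e^{−2ρ})². Then ρ* < 1 − f/2. (In the quenched restricted sandpile model with r-label density f_r = f, this says that the transition density ρ_tr = ρ* differs from — indeed is strictly smaller than — the stationary density ρ_s = 1 − f_r/2.) -/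
/-- for `f ∈ [2/3, 1)`, the unique positive solution `ρ*` of
`ρ - (1/2)(1 - e^{-2ρ}) = ((1 - f)/2)(1 + e^{-2ρ})²` satisfies `ρ* < 1 - f/2`;
i.e. in the quenched restricted sandpile model with `r`-label density `f`, the
transition density is strictly smaller than the stationary density `1 - f/2`. -/
theorem transition_lt_stationary (f ρstar : ℝ)
    (hf₁ : 2 / 3 ≤ f) (hf₂ : f < 1) (hpos : 0 < ρstar)
    (hroot : ρstar - (1 / 2) * (1 - Real.exp (-2 * ρstar))
      = ((1 - f) / 2) * (1 + Real.exp (-2 * ρstar)) ^ 2) :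
    ρstar < 1 - f / 2 := by
  have hu₀ : 0 < Real.exp (-2 * ρstar) := Real.exp_pos _
  have hu₁ : Real.exp (-2 * ρstar) < 1 := Real.exp_lt_one_iff.2 (by linarith)
  generalize Real.exp (-2 * ρstar) = u at *
  by_contra! h
  have hle : u * (1 / 2) ≤ u * ((1 - f) / 2 * (2 + u)) := by linarith
  have hdiv : 1 / 2 ≤ (1 - f) / 2 * (2 + u) := le_of_mul_le_mul_left hle hu₀
  nlinarith [mul_nonneg (sub_nonneg.2 hf₁) hu₀.le]
end

section
/- Consider the three-site system with sites 1, 2, 3 and labels (r, s, r): a toppling of an unstable site 1 decreases η(1) by 2 and increases η(2) by 2; a toppling of an unstable site 2 decreases η(2) by 2 and increases each of η(1), η(3) by 1; a toppling of an unstable site 3 decreases η(3) by 2 and the two particles leave the system. Then for every initial η : {1,2,3} → ℕ: (a) every sequence of legal topplings terminates in a stable configuration ξ (all heights ≤ 1); and (b) if site 2 toppled at least once during the stabilization, then ξ(1) = 1, ξ(2) ≡ η(2) (mod 2), and ξ(3) ≡ η(1) + η(3) + 1 (mod 2). -/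
namespace ThreeSite

/-- One toppling at site `x` in the three-site system with labels `(r, s, r)`
(sites are indexed by `Fin 3`, site `0` has label `r`, site `1` has label `s`,
site `2` has label `r`; particles sent outside `{0,1,2}` are lost):
* toppling site `0` moves two particles to site `1`;
* toppling site `1` moves one particle to each of sites `0` and `2`;
* toppling site `2` removes two particles from the system. -/
def topple3 (η : Fin 3 → ℕ) (x : Fin 3) : Fin 3 → ℕ := fun y =>
  (η y - if y = x then 2 else 0)
    + (if x = 0 ∧ y = 1 then 2 else 0)
    + (if x = 1 ∧ (y = 0 ∨ y = 2) then 1 else 0)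

/-- A legal toppling at site `x`: `x` must be unstable. -/
def StepAt (x : Fin 3) (η η' : Fin 3 → ℕ) : Prop :=
  2 ≤ η x ∧ η' = topple3 η x

/-- A legal toppling at some site. -/
def Step (η η' : Fin 3 → ℕ) : Prop := ∃ x, StepAt x η η'

/-- Reachability by finitely many legal topplings. -/
def Reach : (Fin 3 → ℕ) → (Fin 3 → ℕ) → Prop := Relation.ReflTransGen Step

/-- A configuration is stable when every height is at most `1`. -/
def Stable (η : Fin 3 → ℕ) : Prop := ∀ y, η y ≤ 1

/-- The effect of one legal toppling on the three heights. -/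
theorem Step.heights {η η' : Fin 3 → ℕ} (h : Step η η') :
    (2 ≤ η 0 ∧ η' 0 = η 0 - 2 ∧ η' 1 = η 1 + 2 ∧ η' 2 = η 2) ∨
    (2 ≤ η 1 ∧ η' 0 = η 0 + 1 ∧ η' 1 = η 1 - 2 ∧ η' 2 = η 2 + 1) ∨
    (2 ≤ η 2 ∧ η' 0 = η 0 ∧ η' 1 = η 1 ∧ η' 2 = η 2 - 2) := by
  obtain ⟨x, hx, rfl⟩ := h
  fin_cases x <;> simp_all [topple3]

/-- A weighted particle count that strictly decreases under legal topplings. -/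
def energy (η : Fin 3 → ℕ) : ℕ := 4 * η 0 + 3 * η 1 + η 2

theorem Step.energy_lt {η η' : Fin 3 → ℕ} (h : Step η η') : energy η' < energy η := by
  have := h.heights
  simp only [energy]
  omega

theorem not_exists_infinite_steps : ¬ ∃ f : ℕ → (Fin 3 → ℕ), ∀ k, Step (f k) (f (k + 1)) := by
  rintro ⟨f, hf⟩
  exact not_strictAnti_of_wellFoundedLT (fun k => energy (f k))
    (strictAnti_nat_of_succ_lt fun k => (hf k).energy_lt)

theorem stable_of_forall_not_step {ξ : Fin 3 → ℕ} (h : ∀ ξ', ¬ Step ξ ξ') : Stable ξ := by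
  intro y
  by_contra! hy
  exact h _ ⟨y, hy, rfl⟩

/-- Legal topplings preserve the parities of `η 1` and of `η 0 + η 2`. -/
theorem Reach.parity {η ξ : Fin 3 → ℕ} (h : Reach η ξ) :
    ξ 1 % 2 = η 1 % 2 ∧ (ξ 0 + ξ 2) % 2 = (η 0 + η 2) % 2 := by
  induction h with
  | refl => exact ⟨rfl, rfl⟩
  | tail _ hs ih =>
    have := Step.heights hs
    omega

/-- Once site `0` is occupied or site `1` is unstable, this remains so. -/
theorem Reach.occupied_or_unstable {η ξ : Fin 3 → ℕ} (h : Reach η ξ)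
    (hη : 1 ≤ η 0 ∨ 2 ≤ η 1) : 1 ≤ ξ 0 ∨ 2 ≤ ξ 1 := by
  induction h with
  | refl => exact hη
  | tail _ hs ih =>
    have := Step.heights hs
    omega

/-- in the three-site system with labels `(r, s, r)`,
(a) every sequence of legal topplings terminates (there is no infinite legal
toppling sequence, and any configuration from which no toppling is possible is
stable), and (b) if a stable `ξ` is reached from `η` by legal topplings among
which the middle site toppled at least once, then `ξ 0 = 1`, `ξ 1 ≡ η 1 (mod 2)`
and `ξ 2 ≡ η 0 + η 2 + 1 (mod 2)`. -/
theorem three_site_stabilization (η : Fin 3 → ℕ) :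
    ((¬ ∃ f : ℕ → (Fin 3 → ℕ), f 0 = η ∧ ∀ k, Step (f k) (f (k + 1))) ∧
      ∀ ξ, Reach η ξ → (∀ ξ', ¬ Step ξ ξ') → Stable ξ) ∧
    (∀ ξ, Stable ξ →
      (∃ a b, Reach η a ∧ StepAt 1 a b ∧ Reach b ξ) →
      ξ 0 = 1 ∧ ξ 1 % 2 = η 1 % 2 ∧ ξ 2 % 2 = (η 0 + η 2 + 1) % 2) := by
  refine ⟨⟨fun ⟨f, _, hf⟩ => not_exists_infinite_steps ⟨f, hf⟩,
    fun ξ _ h => stable_of_forall_not_step h⟩, ?_⟩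
  rintro ξ hξ ⟨a, b, hηa, hab, hbξ⟩
  have hb : 1 ≤ b 0 := by simp [hab.2, topple3]
  have hocc := hbξ.occupied_or_unstable (Or.inl hb)
  have hpar := Reach.parity ((hηa.tail ⟨1, hab⟩).trans hbξ)
  have h0 := hξ 0
  have h1 := hξ 1
  have h2 := hξ 2
  omega

end ThreeSite
end

section
/- Let η : ℤ → ℕ be a height configuration and T the parallel toppling map. Suppose T(η)(x) = 0 and T(η)(x+1) = 1, that (η(x), η(x+1)) is neither (0,1) nor (0,0), and that (η(x+1), η(x+2)) ≠ (0,0). Then η(x) = 2, η(x+1) = 0 and η(x+2) = 1. In words: in the absence of the forbidden sub-configuration 00, the pattern 01 cannot be created by a parallel toppling step — if it occurs from x after the step and was not already present from x, then it was present from x+1 before the step, with a 2 at x. -/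
/-- in the absence of the forbidden sub-configuration `00`, the
pattern `01` cannot be created by a parallel toppling step: if after the step the
pattern `01` occurs from `x`, and it did not occur from `x` before the step, and
neither `00` occurs from `x` nor from `x+1` before the step, then before the step
the pattern `01` occurred from `x+1`, with a `2` at `x`. -/
theorem pattern01_travels (η : ℤ → ℕ) (x : ℤ)
    (h0 : parT η x = 0) (h1 : parT η (x + 1) = 1)
    (hnot01 : ¬(η x = 0 ∧ η (x + 1) = 1))
    (hnot00 : ¬(η x = 0 ∧ η (x + 1) = 0))
    (hnot00' : ¬(η (x + 1) = 0 ∧ η (x + 2) = 0)) :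
    η x = 2 ∧ η (x + 1) = 0 ∧ η (x + 2) = 1 := by
  have hx : x + 1 - 1 = x := by ring
  have hx' : x + 1 + 1 = x + 2 := by ring
  simp only [parT, hx, hx'] at h0 h1
  split_ifs at h0 h1 <;> omega
end
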